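/- For every odd integer m with 5 ≤ m ≤ 49, the complete symmetric digraph K_{2m}* admits a resolvable decomposition into directed m-cycles; consequently there are exactly 2(2m-1) resolution classes, each consisting of two vertex-disjoint directed m-cycles. -/

import Mathlib

/-!
Construction.  The vertices of `K_{2m}^*` are two copies of `Z_m`: vertex `x + c * m` is the
element `x` of copy `c`.  For `m ≥ 7` the resolution classes are

* the `m` translates of a starter class, which uses every mixed difference except `0, 1`
  (from copy 0 to copy 1) and `0, -1` (back), and two pure differences `± p` in each copy;
* two irregular classes and their images under `x ↦ -x` composed with exchanging the copies,
  covering the remaining mixed differences and the pure differences `1, 2` (resp. `-1, -2`);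
* for composite `m`, Hamilton cycles of circulant digraphs, taken in both copies,
  together with their negatives, covering the pure differences not coprime to `m`;
* the circulant classes with pure difference `e` in copy 0 and `-e` in copy 1, for the
  remaining `e`.

The resulting list of classes is validated by a kernel computation (`RCD.check`).
-/

namespace RCD

/-- The set of elements of a list, as a bit mask. -/
def mask (l : List ℕ) : ℕ := l.foldr (fun x a => (1 <<< x) ||| a) 0

theorem testBit_mask (l : List ℕ) (i : ℕ) : (mask l).testBit i = true ↔ i ∈ l := by
  induction l with
  | nil => simp [mask]
  | cons x l ih =>
    have : mask (x :: l) = (1 <<< x) ||| mask l := rfl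
    rw [this, Nat.testBit_or, Bool.or_eq_true, ih, Nat.one_shiftLeft, Nat.testBit_two_pow]
    simp [eq_comm]

/-- The arcs of a closed directed cycle, the arc `(u, v)` being coded as `u * n + v`. -/
def arcs (n : ℕ) (h : List ℕ) : List ℕ := List.zipWith (fun u v => u * n + v) h (h.rotate 1)

/-- The arcs of all cycles, as a bit mask. -/
def allArcs (n : ℕ) (rows : List (List ℕ × List ℕ)) : ℕ :=
  rows.foldr (fun r a => mask (arcs n r.1 ++ arcs n r.2) ||| a) 0

theorem testBit_allArcs (n : ℕ) (rows : List (List ℕ × List ℕ)) (i : ℕ) :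
    (allArcs n rows).testBit i = true ↔ ∃ r ∈ rows, i ∈ arcs n r.1 ∨ i ∈ arcs n r.2 := by
  induction rows with
  | nil => simp [allArcs]
  | cons x l ih =>
    have : allArcs n (x :: l) = mask (arcs n x.1 ++ arcs n x.2) ||| allArcs n l := rfl
    rw [this, Nat.testBit_or, Bool.or_eq_true, ih, testBit_mask]
    simp

/-- The codes of the loops, as a bit mask. -/
def loops (n : ℕ) : ℕ := mask ((List.range n).map fun u => u * n + u)

/-- Each class is a pair of `m`-cycles covering all vertices. -/
def checkRow (m : ℕ) (r : List ℕ × List ℕ) : Bool :=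
  r.1.length == m && (r.2.length == m && mask (r.1 ++ r.2) == 2 ^ (2 * m) - 1)

/-- The classes form a resolvable decomposition. -/
def check (m : ℕ) (rows : List (List ℕ × List ℕ)) : Bool :=
  rows.length == 2 * m - 1 && (rows.all (checkRow m) &&
    (allArcs (2 * m) rows ||| loops (2 * m)) == 2 ^ (2 * m * (2 * m)) - 1)

theorem mem_arcs {n m : ℕ} {h : List ℕ} (hl : h.length = m) {c : ℕ} (hc : c ∈ arcs n h) :
    ∃ i, i < m ∧ c = h.getD i 0 * n + h.getD ((i + 1) % m) 0 := by
  obtain ⟨i, hi, rfl⟩ := List.mem_iff_getElem.1 hc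
  have hi' : i < h.length := by
    simp only [arcs, List.length_zipWith, List.length_rotate] at hi; omega
  refine ⟨i, by omega, ?_⟩
  have hm : (i + 1) % m < h.length := by rw [hl]; exact Nat.mod_lt _ (by omega)
  simp only [arcs, List.getElem_zipWith, List.getElem_rotate]
  rw [List.getD_eq_getElem _ _ hi', List.getD_eq_getElem _ _ hm]
  simp only [hl]

theorem of_check (m : ℕ) (h2 : 2 ≤ m) (rows : List (List ℕ × List ℕ))
    (hck : check m rows = true) :
    ∃ C C' : Fin (2 * m - 1) → ZMod m → Fin (2 * m),
      (∀ r, Function.Injective (C r) ∧ Function.Injective (C' r) ∧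
        Disjoint (Set.range (C r)) (Set.range (C' r)) ∧
        Set.range (C r) ∪ Set.range (C' r) = Set.univ) ∧
      (∀ u v : Fin (2 * m), u ≠ v →
        ∃! x : Fin (2 * m - 1) × Bool × ZMod m,
          ((cond x.2.1 (C x.1) (C' x.1)) x.2.2,
           (cond x.2.1 (C x.1) (C' x.1)) (x.2.2 + 1)) = (u, v)) := by
  have : NeZero m := ⟨by omega⟩
  have : Fact (1 < m) := ⟨by omega⟩
  have : NeZero (2 * m) := ⟨by omega⟩
  simp only [check, Bool.and_eq_true, beq_iff_eq, List.all_eq_true] at hck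
  obtain ⟨hlen, hrows, harcs⟩ := hck
  let R : Fin (2 * m - 1) → List ℕ × List ℕ := fun r => rows.getD r.val ([], [])
  have hR : ∀ r, R r ∈ rows := by
    intro r
    have : r.val < rows.length := by rw [hlen]; exact r.isLt
    simp only [R]
    rw [List.getD_eq_getElem _ _ this]
    exact List.getElem_mem _
  have hR' : ∀ x ∈ rows, ∃ r, R r = x := by
    intro x hx
    obtain ⟨i, hi, rfl⟩ := List.mem_iff_getElem.1 hx
    exact ⟨⟨i, by omega⟩, List.getD_eq_getElem _ _ hi⟩
  have hrow : ∀ r, (R r).1.length = m ∧ (R r).2.length = m ∧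
      mask ((R r).1 ++ (R r).2) = 2 ^ (2 * m) - 1 := by
    intro r
    have := hrows _ (hR r)
    simpa only [checkRow, Bool.and_eq_true, beq_iff_eq] using this
  let L : Fin (2 * m - 1) → Bool → List ℕ := fun r b => cond b (R r).1 (R r).2
  have hL : ∀ r b, (L r b).length = m := by
    intro r b; cases b
    · exact (hrow r).2.1
    · exact (hrow r).1
  have hmemL : ∀ r (c : ℕ), (∃ b, c ∈ L r b) ↔ c < 2 * m := by
    intro r c
    have h1 := testBit_mask ((R r).1 ++ (R r).2) c
    rw [(hrow r).2.2, Nat.testBit_two_pow_sub_one, decide_eq_true_iff, List.mem_append] at h1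
    rw [h1]
    simp [L, or_comm]
  let f : Fin (2 * m - 1) → Bool → ZMod m → Fin (2 * m) :=
    fun r b i => Fin.ofNat (2 * m) ((L r b).getD i.val 0)
  have hval : ∀ r b i, (f r b i).val = (L r b).getD i.val 0 := by
    intro r b i
    have hi : i.val < (L r b).length := by rw [hL]; exact ZMod.val_lt i
    simp only [f, Fin.val_ofNat]
    apply Nat.mod_eq_of_lt
    rw [← hmemL r]
    refine ⟨b, ?_⟩
    rw [List.getD_eq_getElem _ _ hi]
    exact List.getElem_mem _
  have hbij : ∀ r, Function.Bijective (fun x : Bool × ZMod m => f r x.1 x.2) := by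
    intro r
    rw [Fintype.bijective_iff_surjective_and_card]
    constructor
    · intro v
      obtain ⟨b, hb⟩ := (hmemL r v.val).2 v.isLt
      obtain ⟨i, hi, hiv⟩ := List.mem_iff_getElem.1 hb
      refine ⟨(b, (i : ZMod m)), ?_⟩
      apply Fin.ext
      simp only [hval]
      rw [ZMod.val_natCast_of_lt (by rw [hL] at hi; exact hi), List.getD_eq_getElem _ _ hi, hiv]
    · simp [ZMod.card]
  let F : Fin (2 * m - 1) × Bool × ZMod m → Fin (2 * m) × Fin (2 * m) :=
    fun x => (f x.1 x.2.1 x.2.2, f x.1 x.2.1 (x.2.2 + 1))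
  have hsurj : ∀ u v : Fin (2 * m), u ≠ v → ∃ x, F x = (u, v) := by
    intro u v huv
    have hlt : u.val * (2 * m) + v.val < 2 * m * (2 * m) := by
      have h1 := u.isLt
      have h2 := v.isLt
      nlinarith
    have hdec : ∀ a b : ℕ, b < 2 * m → u.val * (2 * m) + v.val = a * (2 * m) + b →
        u.val = a ∧ v.val = b := by
      intro a b hb hab
      have h1 := congrArg (· / (2 * m)) hab
      have h3 := congrArg (· % (2 * m)) hab
      have hpos : 0 < 2 * m := by omega
      simp only [Nat.mul_comm _ (2 * m), Nat.mul_add_div hpos, Nat.mul_add_mod,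
        Nat.div_eq_of_lt hb, Nat.div_eq_of_lt v.isLt, Nat.mod_eq_of_lt hb,
        Nat.mod_eq_of_lt v.isLt] at h1 h3
      exact ⟨by simpa using h1, h3⟩
    have hb : (allArcs (2 * m) rows ||| loops (2 * m)).testBit (u.val * (2 * m) + v.val)
        = true := by
      rw [harcs, Nat.testBit_two_pow_sub_one, decide_eq_true_iff]
      exact hlt
    rw [Nat.testBit_or, Bool.or_eq_true, testBit_allArcs, loops, testBit_mask] at hb
    rcases hb with ⟨x, hx, hxa⟩ | hb
    · obtain ⟨r, rfl⟩ := hR' x hx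
      have : ∃ b, u.val * (2 * m) + v.val ∈ arcs (2 * m) (L r b) := by
        rcases hxa with h | h
        · exact ⟨true, h⟩
        · exact ⟨false, h⟩
      obtain ⟨b, hb⟩ := this
      obtain ⟨i, hi, hiv⟩ := mem_arcs (hL r b) hb
      have e1 : (f r b (i : ZMod m)).val = (L r b).getD i 0 := by
        rw [hval, ZMod.val_natCast_of_lt hi]
      have e2 : (f r b ((i : ZMod m) + 1)).val = (L r b).getD ((i + 1) % m) 0 := by
        rw [hval, ZMod.val_add, ZMod.val_natCast_of_lt hi, ZMod.val_one]
      rw [← e1, ← e2] at hiv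
      obtain ⟨h1, h3⟩ := hdec _ _ (Fin.isLt _) hiv
      exact ⟨(r, b, (i : ZMod m)), Prod.ext (Fin.ext h1.symm) (Fin.ext h3.symm)⟩
    · exfalso
      obtain ⟨w, hw, hwe⟩ := List.mem_map.1 hb
      obtain ⟨h1, h3⟩ := hdec w w (List.mem_range.1 hw) hwe.symm
      exact huv (Fin.ext (h1.trans h3.symm))
  have hinj : Function.Injective F := by
    have hsub : (Finset.univ : Finset (Fin (2 * m))).offDiag ⊆ Finset.univ.image F := by
      rintro ⟨u, v⟩ huv
      obtain ⟨x, hx⟩ := hsurj u v (Finset.mem_offDiag.1 huv).2.2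
      exact Finset.mem_image.2 ⟨x, Finset.mem_univ _, hx⟩
    have hc1 := Finset.card_le_card hsub
    have hc2 : (Finset.univ.image F).card ≤ _ := Finset.card_image_le
    have hX : (Finset.univ : Finset (Fin (2 * m - 1) × Bool × ZMod m)).card
        = (Finset.univ : Finset (Fin (2 * m))).offDiag.card := by
      rw [Finset.offDiag_card]
      simp only [Finset.card_univ, Fintype.card_prod, Fintype.card_fin, Fintype.card_bool,
        ZMod.card]
      rw [Nat.sub_mul, Nat.mul_comm (2 * m) (2 * m), one_mul]
    have hc3 : (Finset.univ.image F).card =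
        (Finset.univ : Finset (Fin (2 * m - 1) × Bool × ZMod m)).card := by omega
    intro x y hxy
    exact Finset.card_image_iff.1 hc3 (by simp) (by simp) hxy
  have hcond : ∀ r b, cond b (f r true) (f r false) = f r b := by
    intro r b; cases b <;> rfl
  refine ⟨fun r => f r true, fun r => f r false, ?_, ?_⟩
  · intro r
    refine ⟨?_, ?_, ?_, ?_⟩
    · intro i j hij
      have := @(hbij r).1 (true, i) (true, j) hij
      simpa using this
    · intro i j hij
      have := @(hbij r).1 (false, i) (false, j) hij
      simpa using this
    · rw [Set.disjoint_left]
      rintro _ ⟨i, rfl⟩ ⟨j, hij⟩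
      have := @(hbij r).1 (false, j) (true, i) hij
      simp at this
    · rw [Set.eq_univ_iff_forall]
      intro v
      obtain ⟨⟨b, i⟩, hx⟩ := (hbij r).2 v
      cases b
      · exact Or.inr ⟨i, hx⟩
      · exact Or.inl ⟨i, hx⟩
  · intro u v huv
    obtain ⟨x, hx⟩ := hsurj u v huv
    simp only [hcond]
    exact ⟨x, hx, fun y hy => hinj (hy.trans hx.symm)⟩

/-- Apply a vertex map to a class. -/
def mapRow (g : ℕ → ℕ) (r : List ℕ × List ℕ) : List ℕ × List ℕ := (r.1.map g, r.2.map g)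

/-- Cut a class given as a list of `2m` vertices into its two cycles. -/
def cut (m : ℕ) (l : List ℕ) : List ℕ × List ℕ := (l.take m, l.drop m)

/-- The classes described at the top: starter `s`, irregular classes `d₁`, `d₂`,
Hamilton cycles `hs`, and the list `ex` of (absolute values of) differences which are used
in the starter and in the Hamilton cycles. -/
def build (m : ℕ) (ex : List ℕ) (s d₁ d₂ : List ℕ) (hs : List (List ℕ)) :
    List (List ℕ × List ℕ) :=
  (List.range m).map (fun i => mapRow (fun v => (v % m + i) % m + v / m * m) (cut m s)) ++
  [cut m d₁, mapRow (fun v => (m - v % m) % m + (1 - v / m) * m) (cut m d₁),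
   cut m d₂, mapRow (fun v => (m - v % m) % m + (1 - v / m) * m) (cut m d₂)] ++
  hs.map (fun h => (h, h.map (· + m))) ++
  hs.map (fun h => (h.map (fun x => (m - x) % m), h.map (fun x => (m - x) % m + m))) ++
  (((List.range m).drop 3).filter (fun e => !(ex.elem e) && !(ex.elem (m - e)))).map
    (fun e => ((List.range m).map (fun i => i * e % m),
      (List.range m).map (fun i => (m - i * e % m) % m + m)))

/-- The classes for `m = 5`. -/
def rows5 : List (List ℕ × List ℕ) :=
  [cut 5 [0, 7, 6, 3, 9, 1, 5, 2, 8, 4],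
   cut 5 [0, 3, 1, 4, 5, 2, 7, 9, 8, 6],
   cut 5 [0, 6, 1, 9, 3, 2, 4, 8, 5, 7],
   cut 5 [0, 4, 3, 7, 1, 2, 5, 6, 8, 9],
   cut 5 [0, 2, 9, 6, 4, 1, 7, 8, 3, 5],
   cut 5 [0, 1, 2, 3, 6, 4, 9, 5, 8, 7],
   cut 5 [0, 8, 1, 3, 2, 4, 6, 7, 5, 9],
   cut 5 [0, 5, 3, 4, 7, 1, 8, 2, 6, 9],
   cut 5 [0, 9, 7, 3, 8, 1, 6, 5, 4, 2]]

theorem check5 : check 5 rows5 = true := by decide +kernel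

/-- The classes for `m = 7`. -/
def rows7 : List (List ℕ × List ℕ) :=
  build 7 [3]
    [0, 4, 8, 11, 2, 5, 10, 1, 7, 3, 12, 6, 9, 13]
    [0, 8, 13, 6, 7, 12, 5, 1, 3, 10, 2, 4, 11, 9]
    [0, 1, 2, 10, 9, 8, 7, 3, 4, 6, 13, 5, 12, 11]
    []

theorem check7 : check 7 rows7 = true := by decide +kernel

/-- The classes for `m = 9`. -/
def rows9 : List (List ℕ × List ℕ) :=
  build 9 [3]
    [0, 15, 9, 4, 1, 12, 8, 13, 6, 2, 10, 7, 14, 11, 3, 16, 5, 17]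
    [0, 9, 16, 15, 13, 11, 2, 12, 10, 1, 3, 4, 14, 5, 6, 7, 17, 8]
    [0, 1, 11, 10, 9, 8, 17, 16, 7, 2, 4, 6, 15, 5, 14, 13, 3, 12]
    []

theorem check9 : check 9 rows9 = true := by decide +kernel

/-- The classes for `m = 11`. -/
def rows11 : List (List ℕ × List ℕ) :=
  build 11 [3]
    [0, 13, 21, 6, 20, 1, 16, 19, 10, 2, 18, 3, 11, 9, 15, 5, 12, 7, 4, 14, 8, 17]
    [0, 11, 21, 19, 7, 18, 6, 8, 20, 9, 10, 1, 13, 2, 4, 5, 17, 16, 15, 3, 14, 12]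
    [0, 2, 14, 3, 4, 15, 13, 11, 10, 1, 12, 5, 7, 8, 9, 21, 20, 19, 17, 6, 18, 16]
    []

theorem check11 : check 11 rows11 = true := by decide +kernel

/-- The classes for `m = 13`. -/
def rows13 : List (List ℕ × List ℕ) :=
  build 13 [3]
    [0, 19, 3, 20, 9, 18, 15, 7, 14, 17, 12, 22, 10, 1, 16, 6, 24, 4, 25, 8, 5, 21, 2, 13, 11, 23]
    [0, 2, 4, 17, 3, 16, 15, 1, 14, 25, 11, 12, 13, 5, 7, 21, 8, 9, 10, 24, 23, 22, 20, 6, 19, 18]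
    [0, 14, 1, 2, 15, 13, 25, 23, 9, 11, 24, 10, 12, 3, 5, 6, 8, 22, 21, 7, 20, 19, 17, 4, 18, 16]
    []

theorem check13 : check 13 rows13 = true := by decide +kernel

/-- The classes for `m = 15`. -/
def rows15 : List (List ℕ × List ℕ) :=
  build 15 [3, 4, 5, 6, 7]
    [0, 12, 17, 29, 4, 22, 5, 19, 6, 9, 18, 14, 27, 1, 24, 2, 28, 10, 16, 11, 21, 7, 26, 3, 25,
     13, 15, 8, 20, 23]
    [0, 15, 29, 13, 14, 1, 3, 5, 20, 4, 19, 17, 2, 18, 16, 6, 22, 7, 8, 9, 10, 11, 27, 12, 28, 26,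
     25, 24, 23, 21]
    [0, 2, 17, 1, 16, 15, 14, 29, 28, 27, 11, 26, 10, 12, 13, 3, 4, 6, 8, 24, 9, 25, 23, 7, 22,
     20, 5, 21, 19, 18]
    [[0, 4, 9, 13, 2, 7, 12, 1, 6, 10, 14, 5, 11, 3, 8],
     [0, 5, 9, 14, 4, 8, 12, 2, 6, 11, 1, 7, 13, 3, 10],
     [0, 7, 14, 6, 12, 3, 9, 1, 5, 10, 2, 8, 13, 4, 11],
     [0, 6, 13, 5, 12, 4, 10, 1, 8, 14, 3, 7, 11, 2, 9]]

theorem check15 : check 15 rows15 = true := by decide +kernel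

/-- The classes for `m = 17`. -/
def rows17 : List (List ℕ × List ℕ) :=
  build 17 [3]
    [0, 23, 2, 26, 1, 29, 5, 32, 10, 7, 33, 3, 25, 15, 18, 16, 20, 4, 17, 6, 9, 21, 24, 12, 31, 8,
     22, 13, 28, 14, 30, 27, 11, 19]
    [0, 1, 18, 17, 32, 30, 28, 10, 11, 29, 12, 13, 31, 14, 16, 33, 15, 2, 20, 3, 4, 22, 5, 6, 8,
     9, 27, 26, 24, 7, 25, 23, 21, 19]
    [0, 17, 16, 1, 2, 3, 5, 7, 24, 6, 23, 22, 4, 21, 20, 19, 18, 8, 26, 9, 10, 12, 14, 32, 15, 33,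
     31, 13, 30, 29, 11, 28, 27, 25]
    []

theorem check17 : check 17 rows17 = true := by decide +kernel

/-- The classes for `m = 19`. -/
def rows19 : List (List ℕ × List ℕ) :=
  build 19 [3]
    [0, 16, 29, 4, 25, 9, 26, 23, 18, 36, 2, 30, 8, 24, 27, 17, 21, 10, 32, 1, 34, 3, 33, 5, 31,
     13, 28, 7, 19, 11, 14, 22, 15, 20, 6, 35, 12, 37]
    [0, 1, 2, 21, 20, 19, 18, 37, 35, 16, 36, 34, 33, 13, 32, 12, 14, 15, 17, 3, 4, 24, 5, 7, 26,
     6, 8, 10, 30, 11, 31, 29, 9, 28, 27, 25, 23, 22]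
    [0, 19, 36, 16, 17, 37, 18, 1, 21, 2, 3, 23, 4, 6, 25, 5, 24, 22, 20, 7, 27, 8, 9, 11, 12, 13,
     14, 34, 15, 35, 33, 32, 31, 30, 10, 29, 28, 26]
    []

theorem check19 : check 19 rows19 = true := by decide +kernel

/-- The classes for `m = 21`. -/
def rows21 : List (List ℕ × List ℕ) :=
  build 21 [3, 4, 5, 6, 7, 9, 10]
    [0, 34, 17, 25, 9, 32, 2, 37, 1, 39, 21, 10, 22, 20, 24, 14, 33, 13, 40, 6, 26, 3, 29, 15, 18,
     28, 4, 36, 11, 27, 8, 38, 35, 7, 31, 19, 16, 23, 5, 41, 12, 30]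
    [0, 1, 3, 5, 27, 25, 4, 26, 24, 2, 23, 22, 21, 20, 41, 40, 18, 39, 38, 17, 19, 6, 8, 9, 31,
     10, 11, 12, 34, 13, 15, 36, 14, 16, 37, 35, 33, 32, 30, 29, 7, 28]
    [0, 2, 4, 5, 6, 27, 26, 25, 3, 24, 23, 1, 22, 41, 19, 40, 39, 17, 18, 20, 21, 7, 8, 30, 9, 11,
     33, 12, 14, 15, 37, 16, 38, 36, 35, 13, 34, 32, 10, 31, 29, 28]
    [[0, 6, 13, 19, 4, 10, 16, 2, 12, 18, 7, 17, 3, 9, 15, 1, 8, 14, 20, 5, 11],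
     [0, 10, 20, 9, 16, 1, 7, 14, 3, 13, 2, 8, 18, 4, 11, 17, 6, 12, 19, 5, 15],
     [0, 7, 13, 20, 6, 16, 5, 12, 1, 11, 18, 3, 10, 17, 2, 9, 19, 8, 15, 4, 14],
     [0, 4, 8, 12, 16, 7, 19, 3, 15, 20, 11, 2, 6, 10, 14, 18, 1, 5, 9, 13, 17],
     [0, 12, 17, 8, 13, 4, 16, 20, 3, 7, 11, 15, 19, 2, 14, 5, 10, 1, 6, 18, 9],
     [0, 5, 17, 1, 13, 18, 2, 7, 12, 3, 8, 20, 4, 9, 14, 19, 10, 15, 6, 11, 16]]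

theorem check21 : check 21 rows21 = true := by decide +kernel

/-- The classes for `m = 23`. -/
def rows23 : List (List ℕ × List ℕ) :=
  build 23 [3]
    [0, 38, 19, 24, 22, 32, 20, 31, 9, 29, 8, 34, 18, 35, 6, 28, 14, 30, 17, 44, 4, 36, 33, 1, 21,
     39, 7, 43, 2, 37, 3, 45, 25, 5, 26, 11, 40, 12, 42, 15, 23, 16, 41, 10, 13, 27]
    [0, 23, 45, 43, 42, 19, 20, 44, 21, 22, 1, 25, 2, 3, 5, 6, 30, 29, 27, 4, 28, 26, 24, 7, 9,
     33, 10, 12, 13, 37, 14, 15, 16, 40, 17, 18, 41, 39, 38, 36, 35, 11, 34, 32, 8, 31]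
    [0, 2, 26, 3, 27, 25, 1, 24, 23, 22, 45, 44, 42, 41, 17, 40, 39, 16, 18, 19, 43, 20, 21, 4, 6,
     8, 9, 10, 34, 11, 12, 36, 13, 15, 38, 14, 37, 35, 33, 32, 30, 7, 31, 29, 5, 28]
    []

theorem check23 : check 23 rows23 = true := by decide +kernel

/-- The classes for `m = 25`. -/
def rows25 : List (List ℕ × List ℕ) :=
  build 25 [5, 4, 6, 10]
    [0, 31, 14, 38, 24, 46, 3, 47, 9, 25, 45, 22, 36, 4, 32, 17, 44, 15, 10, 27, 8, 13, 33, 2, 34,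
     1, 41, 11, 40, 18, 26, 5, 43, 23, 35, 19, 28, 16, 39, 12, 48, 20, 30, 6, 49, 29, 21, 42, 7,
     37]
    [0, 25, 49, 47, 22, 48, 23, 24, 1, 27, 2, 3, 4, 6, 32, 7, 8, 34, 33, 31, 5, 30, 29, 28, 26, 9,
     11, 37, 12, 13, 15, 17, 18, 19, 21, 46, 20, 45, 44, 43, 41, 16, 42, 40, 14, 39, 38, 36, 10,
     35]
    [0, 26, 1, 2, 28, 3, 29, 27, 25, 48, 46, 21, 47, 45, 19, 44, 42, 17, 43, 18, 20, 22, 23, 49,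
     24, 4, 5, 7, 33, 8, 9, 35, 10, 11, 13, 39, 14, 15, 16, 41, 40, 38, 12, 37, 36, 34, 32, 6, 31,
     30]
    [[0, 4, 14, 24, 9, 19, 23, 8, 18, 22, 3, 13, 17, 2, 12, 16, 1, 7, 11, 21, 6, 10, 20, 5, 15],
     [0, 10, 14, 18, 24, 3, 9, 15, 19, 4, 8, 12, 22, 7, 13, 23, 2, 6, 16, 20, 1, 5, 11, 17, 21],
     [0, 6, 12, 18, 3, 7, 17, 23, 4, 10, 16, 22, 1, 11, 15, 21, 2, 8, 14, 20, 24, 5, 9, 13, 19]]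

theorem check25 : check 25 rows25 = true := by decide +kernel

/-- The classes for `m = 27`. -/
def rows27 : List (List ℕ × List ℕ) :=
  build 27 [3, 4, 6, 9, 12]
    [0, 24, 28, 11, 45, 42, 21, 39, 10, 29, 16, 46, 49, 26, 48, 13, 33, 22, 37, 6, 50, 1, 27, 2,
     31, 5, 41, 3, 38, 18, 43, 9, 12, 51, 8, 32, 20, 34, 19, 52, 15, 53, 7, 47, 23, 44, 14, 30,
     25, 35, 17, 40, 4, 36]
    [0, 28, 1, 2, 30, 3, 4, 5, 7, 8, 36, 9, 11, 38, 10, 37, 35, 34, 6, 33, 32, 31, 29, 27, 53, 25,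
     26, 12, 13, 15, 16, 18, 20, 22, 50, 23, 24, 52, 51, 49, 21, 48, 47, 19, 46, 45, 17, 44, 43,
     42, 14, 41, 40, 39]
    [0, 2, 29, 1, 3, 31, 4, 6, 8, 10, 38, 11, 39, 37, 9, 36, 35, 7, 34, 33, 5, 32, 30, 28, 53, 26,
     27, 12, 14, 16, 17, 18, 46, 19, 21, 23, 51, 24, 25, 52, 50, 22, 49, 48, 20, 47, 45, 44, 42,
     15, 43, 41, 13, 40]
    [[0, 15, 6, 2, 20, 11, 7, 25, 21, 17, 5, 23, 14, 8, 4, 19, 13, 9, 3, 26, 22, 16, 10, 1, 24,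
      18, 12],
     [0, 21, 12, 8, 23, 11, 2, 25, 16, 7, 1, 19, 15, 3, 18, 9, 24, 20, 14, 5, 26, 17, 13, 4, 22,
      10, 6],
     [0, 23, 19, 10, 4, 25, 13, 7, 3, 24, 15, 11, 5, 1, 22, 18, 14, 2, 17, 8, 26, 20, 16, 12, 6,
      21, 9],
     [0, 18, 6, 24, 12, 3, 21, 15, 9, 5, 20, 8, 2, 23, 17, 11, 26, 14, 10, 25, 19, 7, 22, 13, 1,
      16, 4]]

theorem check27 : check 27 rows27 = true := by decide +kernel

/-- The classes for `m = 29`. -/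
def rows29 : List (List ℕ × List ℕ) :=
  build 29 [3]
    [0, 45, 23, 46, 27, 41, 9, 31, 3, 34, 28, 43, 12, 52, 19, 40, 22, 35, 25, 32, 18, 53, 4, 36,
     15, 39, 42, 8, 55, 1, 29, 13, 10, 48, 21, 24, 49, 11, 30, 17, 54, 51, 5, 44, 20, 37, 14, 47,
     7, 56, 2, 57, 16, 50, 6, 33, 26, 38]
    [0, 2, 4, 34, 33, 3, 32, 31, 1, 30, 29, 28, 57, 56, 26, 55, 53, 24, 54, 52, 51, 49, 20, 50,
     21, 22, 23, 25, 27, 5, 7, 37, 8, 10, 39, 9, 11, 12, 13, 15, 45, 16, 18, 19, 48, 47, 17, 46,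
     44, 14, 43, 42, 41, 40, 38, 36, 6, 35]
    [0, 1, 31, 2, 3, 33, 4, 5, 6, 36, 7, 8, 9, 39, 38, 37, 35, 34, 32, 30, 57, 55, 54, 25, 26, 56,
     27, 28, 29, 10, 12, 42, 13, 14, 16, 46, 17, 19, 21, 51, 22, 24, 53, 23, 52, 50, 20, 49, 48,
     18, 47, 45, 15, 44, 43, 41, 11, 40]
    []

theorem check29 : check 29 rows29 = true := by decide +kernel

/-- The classes for `m = 31`. -/
def rows31 : List (List ℕ × List ℕ) :=
  build 31 [3]
    [0, 45, 29, 41, 14, 61, 5, 2, 40, 23, 34, 19, 46, 26, 39, 21, 47, 4, 53, 25, 50, 16, 36, 30,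
     49, 13, 42, 12, 60, 22, 57, 1, 56, 17, 38, 9, 55, 15, 18, 58, 3, 44, 11, 48, 51, 6, 59, 7,
     37, 27, 35, 32, 28, 33, 10, 43, 24, 52, 8, 31, 20, 54]
    [0, 31, 60, 29, 61, 30, 1, 33, 2, 3, 4, 6, 8, 40, 9, 11, 43, 12, 44, 42, 10, 41, 39, 7, 38,
     37, 5, 36, 35, 34, 32, 13, 14, 46, 15, 16, 17, 19, 20, 21, 22, 54, 23, 24, 26, 28, 59, 27,
     58, 57, 25, 56, 55, 53, 52, 51, 49, 18, 50, 48, 47, 45]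
    [0, 32, 1, 3, 34, 2, 4, 36, 5, 7, 39, 8, 10, 42, 11, 12, 43, 41, 9, 40, 38, 6, 37, 35, 33, 31,
     61, 60, 28, 29, 30, 13, 15, 47, 16, 18, 19, 51, 20, 22, 23, 25, 26, 58, 27, 59, 57, 56, 24,
     55, 54, 53, 21, 52, 50, 49, 17, 48, 46, 14, 45, 44]
    []

theorem check31 : check 31 rows31 = true := by decide +kernel

/-- The classes for `m = 33`. -/
def rows33 : List (List ℕ × List ℕ) :=
  build 33 [3, 6, 7, 9, 10, 11, 12, 13, 15, 16]
    [0, 42, 24, 51, 23, 53, 3, 52, 32, 38, 9, 6, 47, 10, 13, 63, 11, 49, 22, 46, 1, 37, 21, 64,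
     61, 2, 56, 12, 34, 31, 33, 28, 65, 4, 35, 26, 44, 20, 40, 30, 43, 8, 36, 15, 62, 14, 39, 17,
     57, 27, 59, 18, 41, 16, 60, 29, 48, 25, 54, 7, 55, 58, 19, 45, 5, 50]
    [0, 33, 64, 63, 62, 60, 59, 57, 55, 54, 52, 19, 53, 20, 21, 22, 56, 23, 24, 58, 25, 26, 27,
     61, 28, 29, 30, 31, 65, 32, 1, 35, 34, 2, 4, 38, 5, 6, 40, 7, 8, 42, 9, 10, 11, 45, 12, 13,
     14, 15, 49, 16, 17, 18, 51, 50, 48, 47, 46, 44, 43, 41, 39, 37, 3, 36]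
    [0, 34, 1, 2, 35, 33, 65, 63, 61, 59, 25, 58, 57, 23, 56, 54, 20, 53, 19, 21, 55, 22, 24, 26,
     60, 27, 28, 62, 29, 31, 64, 30, 32, 3, 37, 4, 5, 39, 6, 8, 10, 44, 11, 13, 15, 17, 51, 18,
     52, 50, 16, 49, 47, 14, 48, 46, 12, 45, 43, 9, 42, 41, 7, 40, 38, 36]
    [[0, 17, 29, 13, 22, 6, 18, 30, 9, 26, 5, 14, 31, 7, 16, 25, 1, 10, 27, 11, 23, 2, 19, 28, 12,
      24, 3, 15, 32, 8, 20, 4, 21],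
     [0, 9, 18, 27, 3, 12, 21, 5, 17, 26, 2, 14, 23, 32, 11, 20, 29, 8, 25, 4, 16, 28, 7, 19, 31,
      10, 22, 1, 13, 30, 6, 15, 24],
     [0, 12, 29, 5, 22, 31, 15, 27, 6, 23, 7, 24, 8, 17, 1, 18, 2, 11, 28, 4, 13, 25, 9, 21, 30,
      14, 26, 10, 19, 3, 20, 32, 16],
     [0, 7, 14, 21, 28, 13, 20, 27, 12, 30, 15, 22, 29, 3, 10, 17, 2, 9, 16, 1, 19, 4, 11, 18, 25,
      32, 6, 24, 31, 5, 23, 8, 26],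
     [0, 18, 3, 21, 6, 13, 31, 16, 23, 30, 4, 22, 7, 25, 10, 28, 2, 20, 5, 12, 19, 26, 11, 29, 14,
      32, 17, 24, 9, 27, 1, 8, 15],
     [0, 13, 26, 4, 17, 28, 8, 2, 15, 25, 19, 32, 12, 6, 16, 27, 5, 18, 29, 7, 20, 30, 10, 23, 3,
      14, 24, 1, 11, 21, 31, 9, 22],
     [0, 10, 21, 32, 26, 6, 19, 13, 24, 4, 14, 27, 7, 17, 30, 8, 18, 31, 11, 22, 2, 12, 25, 3, 16,
      29, 23, 1, 28, 5, 15, 9, 20],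
     [0, 11, 5, 32, 9, 19, 30, 24, 18, 28, 22, 16, 10, 20, 14, 8, 21, 15, 26, 3, 13, 7, 1, 12, 23,
      17, 27, 4, 31, 25, 2, 29, 6],
     [0, 27, 21, 1, 14, 25, 5, 16, 26, 20, 31, 8, 19, 29, 9, 3, 30, 7, 18, 12, 22, 32, 10, 4, 15,
      28, 6, 17, 11, 24, 2, 13, 23]]

theorem check33 : check 33 rows33 = true := by decide +kernel

/-- The classes for `m = 35`. -/
def rows35 : List (List ℕ × List ℕ) :=
  build 35 [5, 4, 7, 10, 13, 14, 15, 17]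
    [0, 43, 23, 57, 1, 54, 28, 52, 14, 56, 27, 36, 24, 40, 16, 49, 4, 65, 22, 39, 8, 53, 2, 58, 5,
     69, 29, 42, 17, 12, 51, 10, 48, 6, 68, 3, 44, 21, 41, 46, 9, 37, 26, 66, 32, 62, 34, 59, 7,
     61, 31, 63, 19, 50, 11, 60, 55, 33, 45, 30, 67, 13, 18, 64, 15, 38, 25, 47, 20, 35]
    [0, 35, 69, 34, 1, 3, 4, 40, 5, 6, 7, 9, 10, 12, 48, 13, 15, 51, 50, 14, 49, 47, 11, 46, 45,
     44, 8, 43, 42, 41, 39, 38, 2, 37, 36, 16, 17, 19, 54, 18, 20, 22, 58, 23, 25, 61, 26, 28, 64,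
     29, 30, 66, 31, 33, 68, 32, 67, 65, 63, 27, 62, 60, 24, 59, 57, 21, 56, 55, 53, 52]
    [0, 36, 35, 68, 67, 31, 66, 64, 28, 63, 62, 61, 25, 60, 59, 58, 57, 56, 20, 55, 54, 19, 21,
     22, 23, 24, 26, 27, 29, 65, 30, 32, 34, 69, 33, 1, 2, 4, 5, 41, 6, 8, 44, 9, 11, 47, 12, 14,
     16, 18, 53, 17, 52, 51, 15, 50, 49, 13, 48, 46, 10, 45, 43, 7, 42, 40, 39, 3, 38, 37]
    [[0, 22, 9, 34, 27, 20, 7, 29, 16, 3, 28, 15, 8, 33, 19, 5, 30, 23, 13, 6, 31, 21, 14, 4, 32,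
      25, 18, 11, 1, 26, 12, 2, 24, 17, 10],
     [0, 28, 18, 5, 26, 19, 12, 33, 20, 10, 3, 24, 14, 1, 23, 9, 31, 17, 4, 25, 11, 32, 22, 8, 29,
      15, 2, 30, 16, 6, 27, 13, 34, 21, 7],
     [0, 25, 15, 1, 22, 12, 5, 27, 14, 7, 28, 21, 8, 30, 17, 3, 31, 24, 11, 33, 26, 16, 9, 2, 23,
      10, 32, 18, 4, 29, 19, 6, 34, 20, 13],
     [0, 21, 11, 4, 26, 13, 3, 25, 12, 34, 24, 10, 31, 18, 8, 1, 29, 22, 15, 5, 33, 23, 16, 2, 27,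
      17, 7, 32, 19, 9, 30, 20, 6, 28, 14],
     [0, 20, 16, 1, 21, 4, 22, 5, 23, 8, 28, 24, 7, 25, 10, 6, 26, 11, 31, 27, 12, 30, 13, 9, 29,
      14, 32, 17, 2, 33, 18, 3, 34, 19, 15],
     [0, 18, 1, 19, 2, 20, 3, 21, 17, 13, 31, 14, 10, 28, 11, 29, 12, 32, 15, 33, 16, 34, 30, 26,
      22, 7, 27, 23, 6, 24, 9, 5, 25, 8, 4],
     [0, 31, 16, 12, 8, 26, 9, 27, 10, 30, 15, 11, 7, 3, 23, 19, 4, 24, 20, 5, 1, 32, 28, 13, 33,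
      29, 25, 21, 6, 2, 22, 18, 14, 34, 17]]

theorem check35 : check 35 rows35 = true := by decide +kernel

/-- The classes for `m = 37`. -/
def rows37 : List (List ℕ × List ℕ) :=
  build 37 [3]
    [0, 63, 8, 73, 27, 58, 18, 38, 24, 49, 5, 50, 35, 67, 31, 40, 28, 57, 34, 61, 20, 70, 14, 72,
     3, 37, 2, 46, 30, 48, 51, 9, 60, 1, 55, 10, 71, 4, 45, 42, 25, 47, 16, 39, 11, 59, 29, 44,
     15, 54, 33, 36, 41, 17, 64, 7, 43, 32, 65, 22, 19, 68, 21, 56, 23, 53, 26, 69, 6, 62, 12, 52,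
     13, 66]
    [0, 2, 3, 4, 42, 5, 7, 45, 8, 9, 11, 49, 12, 13, 15, 53, 16, 17, 54, 52, 14, 51, 50, 48, 10,
     47, 46, 44, 6, 43, 41, 40, 39, 37, 36, 1, 38, 18, 20, 21, 22, 24, 62, 25, 26, 27, 29, 31, 69,
     32, 34, 72, 35, 73, 71, 33, 70, 68, 30, 67, 66, 28, 65, 64, 63, 61, 23, 60, 59, 58, 56, 19,
     57, 55]
    [0, 37, 73, 72, 34, 71, 69, 68, 66, 64, 26, 63, 62, 60, 22, 59, 57, 19, 20, 58, 21, 23, 61,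
     24, 25, 27, 65, 28, 29, 67, 30, 31, 32, 70, 33, 35, 36, 1, 39, 2, 4, 5, 43, 6, 7, 9, 47, 10,
     12, 50, 13, 14, 16, 54, 17, 18, 56, 55, 53, 15, 52, 51, 49, 11, 48, 46, 8, 45, 44, 42, 41, 3,
     40, 38]
    []

theorem check37 : check 37 rows37 = true := by decide +kernel

/-- The classes for `m = 39`. -/
def rows39 : List (List ℕ × List ℕ) :=
  build 39 [3, 6, 7, 9, 10, 12, 13, 15, 16, 18]
    [0, 59, 22, 68, 27, 55, 10, 61, 25, 39, 9, 6, 51, 33, 63, 36, 46, 13, 71, 18, 62, 38, 41, 44,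
     1, 65, 34, 75, 26, 76, 14, 70, 5, 8, 74, 19, 73, 31, 67, 2, 57, 35, 69, 17, 40, 11, 48, 4,
     47, 32, 53, 15, 72, 21, 45, 20, 58, 12, 43, 23, 56, 24, 50, 3, 77, 29, 42, 7, 54, 37, 66, 16,
     64, 30, 52, 49, 28, 60]
    [0, 2, 4, 5, 45, 6, 7, 47, 8, 9, 11, 51, 12, 13, 53, 14, 15, 17, 57, 56, 16, 55, 54, 52, 50,
     10, 49, 48, 46, 44, 43, 3, 42, 40, 1, 41, 39, 77, 38, 18, 19, 59, 20, 21, 23, 25, 26, 66, 27,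
     28, 29, 69, 30, 31, 71, 32, 33, 35, 36, 37, 76, 75, 74, 34, 73, 72, 70, 68, 67, 65, 64, 24,
     63, 62, 22, 61, 60, 58]
    [0, 40, 77, 76, 36, 75, 73, 71, 70, 30, 69, 68, 28, 67, 66, 26, 65, 63, 23, 62, 60, 21, 61,
     22, 24, 64, 25, 27, 29, 31, 32, 72, 33, 34, 74, 35, 37, 38, 39, 1, 3, 43, 4, 6, 46, 7, 9, 49,
     10, 12, 14, 16, 17, 19, 20, 59, 57, 18, 58, 56, 55, 15, 54, 53, 13, 52, 51, 11, 50, 48, 8,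
     47, 45, 5, 44, 42, 2, 41]
    [[0, 33, 3, 12, 6, 15, 24, 34, 28, 38, 9, 18, 27, 36, 7, 1, 10, 4, 37, 31, 25, 19, 13, 22, 16,
      26, 20, 29, 23, 32, 2, 35, 5, 14, 8, 17, 11, 21, 30],
     [0, 10, 19, 29, 38, 8, 18, 28, 37, 7, 16, 25, 34, 5, 15, 9, 3, 36, 30, 1, 11, 20, 14, 24, 33,
      4, 13, 23, 17, 27, 21, 31, 2, 12, 22, 32, 26, 35, 6],
     [0, 9, 19, 28, 22, 31, 1, 34, 4, 14, 23, 33, 27, 37, 8, 2, 11, 5, 38, 32, 3, 13, 7, 17, 26,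
      36, 6, 16, 10, 20, 30, 24, 18, 12, 21, 15, 25, 35, 29],
     [0, 18, 34, 11, 27, 3, 19, 37, 13, 29, 6, 22, 38, 15, 30, 7, 25, 1, 16, 31, 10, 26, 5, 21,
      36, 12, 28, 4, 20, 35, 14, 32, 8, 23, 2, 17, 33, 9, 24],
     [0, 15, 31, 7, 22, 37, 16, 34, 10, 25, 2, 20, 36, 13, 28, 5, 23, 38, 14, 29, 8, 24, 1, 17,
      32, 9, 27, 4, 19, 35, 11, 26, 3, 18, 33, 12, 30, 6, 21],
     [0, 16, 32, 11, 29, 5, 20, 38, 17, 35, 12, 27, 6, 24, 3, 21, 37, 14, 30, 9, 25, 4, 22, 1, 19,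
      34, 13, 31, 8, 26, 2, 18, 36, 15, 33, 10, 28, 7, 23],
     [0, 7, 34, 8, 15, 3, 16, 4, 11, 38, 26, 14, 2, 29, 17, 30, 18, 25, 13, 20, 27, 1, 28, 35, 23,
      36, 24, 31, 19, 32, 6, 33, 21, 9, 22, 10, 37, 5, 12],
     [0, 27, 34, 2, 15, 22, 29, 3, 30, 4, 31, 5, 32, 20, 33, 1, 8, 35, 9, 36, 10, 17, 24, 37, 25,
      38, 12, 19, 7, 14, 21, 28, 16, 23, 11, 18, 6, 13, 26],
     [0, 13, 1, 14, 27, 15, 28, 2, 9, 16, 29, 36, 4, 17, 5, 18, 31, 38, 6, 19, 26, 33, 7, 20, 8,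
      21, 34, 22, 35, 3, 10, 23, 30, 37, 11, 24, 12, 25, 32]]

theorem check39 : check 39 rows39 = true := by decide +kernel

/-- The classes for `m = 41`. -/
def rows41 : List (List ℕ × List ℕ) :=
  build 41 [3]
    [0, 75, 14, 60, 39, 76, 27, 71, 3, 46, 16, 47, 28, 66, 18, 42, 80, 21, 44, 12, 72, 7, 59, 62,
     24, 79, 9, 57, 1, 50, 33, 36, 48, 37, 53, 6, 67, 32, 68, 22, 69, 2, 65, 34, 51, 29, 56, 11,
     73, 19, 54, 20, 74, 31, 41, 15, 81, 4, 78, 38, 77, 40, 70, 13, 63, 8, 64, 25, 43, 10, 55, 30,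
     58, 5, 45, 35, 61, 17, 49, 26, 23, 52]
    [0, 41, 81, 80, 39, 40, 1, 3, 5, 6, 8, 50, 9, 10, 52, 11, 13, 55, 14, 15, 16, 58, 17, 59, 57,
     56, 54, 12, 53, 51, 49, 7, 48, 47, 46, 4, 45, 43, 2, 44, 42, 18, 20, 62, 21, 23, 64, 22, 24,
     66, 25, 27, 69, 28, 29, 30, 72, 31, 32, 74, 33, 35, 77, 36, 37, 38, 79, 78, 76, 34, 75, 73,
     71, 70, 68, 26, 67, 65, 63, 61, 19, 60]
    [0, 42, 1, 43, 41, 80, 79, 37, 78, 77, 35, 76, 75, 33, 74, 72, 70, 28, 69, 67, 25, 66, 65, 64,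
     23, 24, 26, 68, 27, 29, 71, 30, 31, 73, 32, 34, 36, 38, 39, 81, 40, 2, 4, 46, 5, 7, 8, 9, 51,
     10, 11, 53, 12, 13, 14, 16, 18, 19, 20, 22, 63, 21, 62, 61, 60, 59, 17, 58, 57, 15, 56, 55,
     54, 52, 50, 49, 48, 6, 47, 45, 3, 44]
    []

theorem check41 : check 41 rows41 = true := by decide +kernel

/-- The classes for `m = 43`. -/
def rows43 : List (List ℕ × List ℕ) :=
  build 43 [3]
    [0, 83, 43, 1, 75, 2, 73, 11, 58, 7, 70, 23, 52, 40, 74, 18, 80, 17, 56, 38, 53, 37, 45, 16,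
     62, 9, 82, 30, 71, 21, 57, 3, 81, 14, 78, 33, 49, 10, 77, 6, 51, 5, 60, 4, 54, 39, 61, 35,
     72, 31, 34, 66, 28, 84, 19, 85, 8, 65, 32, 29, 47, 22, 48, 12, 50, 36, 46, 25, 79, 13, 55,
     24, 76, 41, 68, 20, 69, 42, 67, 64, 15, 63, 26, 59, 27, 44]
    [0, 2, 45, 1, 44, 43, 42, 85, 84, 82, 38, 81, 80, 36, 79, 77, 75, 31, 74, 73, 29, 72, 71, 69,
     68, 24, 25, 26, 70, 27, 28, 30, 32, 76, 33, 34, 78, 35, 37, 39, 83, 40, 41, 3, 47, 4, 5, 49,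
     6, 7, 51, 8, 10, 11, 12, 14, 16, 60, 17, 19, 20, 64, 21, 22, 66, 23, 67, 65, 63, 62, 18, 61,
     59, 15, 58, 57, 13, 56, 55, 54, 53, 9, 52, 50, 48, 46]
    [0, 43, 85, 83, 81, 79, 78, 77, 33, 76, 74, 30, 73, 72, 28, 71, 70, 69, 25, 68, 67, 24, 26,
     27, 29, 31, 75, 32, 34, 35, 36, 80, 37, 38, 82, 39, 41, 84, 40, 42, 1, 45, 44, 2, 3, 4, 6, 8,
     52, 9, 10, 54, 11, 13, 15, 59, 16, 18, 20, 22, 23, 66, 65, 21, 64, 62, 19, 63, 61, 17, 60,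
     58, 14, 57, 56, 12, 55, 53, 51, 7, 50, 49, 5, 48, 47, 46]
    []

theorem check43 : check 43 rows43 = true := by decide +kernel

/-- The classes for `m = 45`. -/
def rows45 : List (List ℕ × List ℕ) :=
  build 45 [3, 5, 6, 8, 9, 10, 11, 12, 13, 15, 16, 17, 18, 20, 21, 22]
    [0, 84, 22, 70, 12, 78, 25, 62, 44, 54, 20, 88, 38, 72, 18, 21, 53, 34, 45, 33, 64, 4, 61, 32,
     79, 9, 67, 36, 50, 14, 68, 35, 73, 1, 66, 63, 41, 77, 2, 65, 24, 57, 29, 55, 3, 5, 75, 40,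
     47, 7, 69, 43, 85, 16, 51, 8, 82, 23, 74, 27, 80, 42, 86, 37, 87, 31, 46, 49, 26, 48, 6, 81,
     30, 71, 39, 58, 10, 83, 17, 89, 28, 52, 13, 56, 19, 59, 15, 76, 11, 60]
    [0, 2, 48, 3, 4, 49, 47, 1, 46, 45, 44, 89, 88, 87, 85, 84, 82, 36, 81, 80, 34, 79, 78, 32,
     77, 76, 74, 73, 27, 28, 29, 75, 30, 31, 33, 35, 37, 83, 38, 39, 41, 86, 40, 42, 43, 5, 51, 6,
     7, 8, 10, 12, 13, 59, 14, 15, 61, 16, 18, 20, 66, 21, 22, 24, 26, 72, 71, 25, 70, 69, 23, 68,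
     67, 65, 19, 64, 63, 17, 62, 60, 58, 57, 11, 56, 55, 9, 54, 53, 52, 50]
    [0, 1, 47, 2, 4, 5, 7, 53, 8, 9, 55, 10, 11, 13, 15, 16, 62, 17, 18, 63, 61, 60, 14, 59, 58,
     12, 57, 56, 54, 52, 6, 51, 50, 49, 3, 48, 46, 89, 87, 41, 42, 88, 43, 44, 45, 19, 21, 23, 69,
     24, 25, 27, 72, 26, 28, 74, 29, 31, 77, 32, 34, 80, 35, 36, 82, 37, 39, 85, 40, 86, 84, 38,
     83, 81, 79, 33, 78, 76, 30, 75, 73, 71, 70, 68, 22, 67, 66, 20, 65, 64]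
    [[0, 37, 10, 2, 39, 12, 42, 34, 26, 18, 36, 28, 20, 5, 23, 41, 14, 32, 24, 16, 1, 38, 30, 15,
      7, 44, 29, 21, 13, 31, 4, 22, 40, 25, 17, 9, 27, 19, 11, 3, 33, 6, 43, 35, 8],
     [0, 30, 22, 7, 25, 10, 40, 13, 43, 28, 1, 31, 16, 8, 26, 11, 41, 33, 18, 3, 21, 6, 36, 9, 39,
      24, 42, 27, 12, 4, 34, 19, 37, 29, 14, 44, 17, 2, 32, 5, 35, 20, 38, 23, 15],
     [0, 18, 10, 28, 13, 5, 42, 15, 33, 25, 43, 16, 34, 7, 37, 22, 14, 6, 24, 9, 1, 19, 4, 41, 26,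
      44, 36, 21, 39, 31, 23, 8, 38, 11, 29, 2, 20, 12, 30, 3, 40, 32, 17, 35, 27],
     [0, 33, 44, 23, 2, 26, 5, 16, 4, 28, 7, 31, 42, 30, 18, 6, 39, 27, 15, 3, 14, 38, 17, 41, 29,
      40, 19, 43, 22, 10, 21, 9, 20, 8, 32, 11, 35, 1, 34, 13, 37, 25, 36, 24, 12],
     [0, 11, 22, 1, 25, 13, 24, 3, 27, 38, 4, 37, 16, 40, 6, 17, 28, 39, 5, 29, 8, 41, 7, 18, 42,
      21, 32, 20, 44, 10, 43, 31, 19, 30, 9, 33, 12, 36, 15, 26, 14, 2, 35, 23, 34],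
     [0, 24, 35, 14, 25, 4, 15, 39, 18, 29, 17, 5, 38, 26, 37, 3, 36, 2, 13, 1, 12, 23, 11, 44,
      32, 43, 9, 42, 8, 19, 7, 40, 28, 16, 27, 6, 30, 41, 20, 31, 10, 34, 22, 33, 21],
     [0, 32, 12, 37, 17, 26, 6, 31, 11, 36, 16, 25, 34, 43, 30, 10, 42, 22, 2, 27, 7, 39, 19, 28,
      15, 24, 4, 29, 9, 41, 21, 1, 33, 13, 38, 18, 5, 14, 23, 3, 35, 44, 8, 40, 20],
     [0, 25, 5, 30, 39, 3, 12, 44, 31, 18, 27, 14, 1, 26, 13, 22, 9, 34, 21, 8, 17, 42, 29, 16,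
      41, 28, 37, 24, 33, 20, 7, 32, 19, 6, 38, 2, 11, 43, 23, 10, 35, 15, 40, 4, 36],
     [0, 9, 18, 43, 7, 16, 3, 28, 8, 33, 42, 6, 15, 2, 34, 14, 39, 26, 35, 22, 31, 40, 27, 36, 23,
      32, 41, 5, 37, 1, 10, 19, 44, 24, 11, 20, 29, 38, 25, 12, 21, 30, 17, 4, 13],
     [0, 39, 29, 19, 13, 7, 42, 32, 26, 16, 6, 35, 25, 9, 3, 38, 22, 12, 2, 41, 31, 21, 15, 44,
      28, 18, 8, 43, 37, 27, 11, 5, 40, 34, 24, 14, 4, 33, 23, 17, 1, 36, 30, 20, 10],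
     [0, 35, 29, 13, 42, 26, 10, 4, 39, 23, 7, 36, 20, 14, 43, 33, 27, 17, 11, 1, 40, 30, 24, 8,
      37, 21, 5, 44, 34, 18, 2, 31, 15, 9, 38, 28, 12, 6, 41, 25, 19, 3, 32, 22, 16],
     [0, 29, 23, 13, 3, 42, 36, 26, 20, 4, 43, 27, 21, 11, 40, 24, 18, 12, 41, 35, 19, 9, 44, 38,
      32, 16, 10, 39, 33, 17, 7, 1, 30, 14, 8, 2, 37, 31, 25, 15, 5, 34, 28, 22, 6],
     [0, 28, 23, 6, 1, 41, 36, 31, 26, 21, 16, 38, 15, 43, 20, 42, 37, 32, 27, 22, 17, 12, 40, 35,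
      18, 13, 8, 3, 25, 2, 30, 7, 29, 24, 19, 14, 9, 4, 44, 39, 34, 11, 33, 10, 5],
     [0, 40, 23, 18, 1, 29, 6, 28, 5, 27, 4, 32, 9, 37, 20, 15, 10, 38, 33, 16, 11, 39, 22, 44,
      21, 43, 26, 3, 31, 14, 36, 19, 41, 24, 7, 2, 42, 25, 8, 30, 13, 35, 12, 34, 17],
     [0, 22, 5, 33, 28, 11, 6, 34, 29, 12, 7, 35, 30, 25, 20, 3, 43, 38, 21, 4, 26, 9, 31, 8, 36,
      13, 41, 18, 40, 17, 39, 16, 44, 27, 10, 32, 15, 37, 14, 42, 19, 2, 24, 1, 23]]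

theorem check45 : check 45 rows45 = true := by decide +kernel

/-- The classes for `m = 47`. -/
def rows47 : List (List ℕ × List ℕ) :=
  build 47 [3]
    [0, 79, 22, 92, 89, 10, 13, 86, 19, 78, 2, 74, 38, 81, 29, 65, 14, 49, 40, 68, 71, 16, 55, 1,
     56, 25, 59, 26, 47, 45, 60, 23, 64, 18, 75, 34, 63, 35, 87, 15, 73, 43, 85, 21, 72, 28, 82,
     3, 67, 46, 83, 44, 50, 36, 80, 6, 77, 24, 93, 20, 69, 9, 70, 4, 91, 33, 66, 32, 51, 39, 48,
     30, 61, 37, 53, 11, 76, 7, 52, 12, 62, 17, 84, 41, 54, 31, 58, 8, 5, 90, 27, 57, 42, 88]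
    [0, 48, 1, 49, 47, 92, 45, 93, 91, 89, 41, 88, 87, 39, 86, 85, 37, 84, 83, 81, 33, 80, 79, 77,
     76, 74, 73, 26, 27, 75, 28, 29, 30, 78, 31, 32, 34, 82, 35, 36, 38, 40, 42, 90, 43, 44, 46,
     2, 4, 5, 7, 8, 10, 12, 60, 13, 15, 63, 16, 18, 66, 19, 20, 68, 21, 22, 23, 25, 72, 24, 71,
     70, 69, 67, 65, 17, 64, 62, 14, 61, 59, 11, 58, 57, 9, 56, 55, 54, 6, 53, 52, 51, 3, 50]
    [0, 1, 2, 50, 3, 4, 52, 5, 6, 54, 7, 9, 10, 58, 11, 12, 14, 16, 64, 17, 19, 21, 69, 68, 20,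
     67, 66, 18, 65, 63, 15, 62, 61, 13, 60, 59, 57, 56, 8, 55, 53, 51, 49, 48, 93, 46, 47, 22,
     24, 26, 28, 30, 31, 33, 34, 36, 84, 37, 39, 87, 40, 41, 89, 42, 44, 45, 92, 91, 43, 90, 88,
     86, 38, 85, 83, 35, 82, 81, 80, 32, 79, 78, 77, 29, 76, 75, 27, 74, 72, 25, 73, 71, 23, 70]
    []

theorem check47 : check 47 rows47 = true := by decide +kernel

/-- The classes for `m = 49`. -/
def rows49 : List (List ℕ × List ℕ) :=
  build 49 [7, 14, 21, 22]
    [0, 63, 22, 87, 40, 52, 47, 50, 35, 86, 11, 75, 8, 61, 29, 62, 16, 95, 26, 49, 5, 59, 32, 54,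
     12, 72, 48, 41, 68, 6, 81, 1, 91, 23, 58, 37, 66, 13, 56, 28, 96, 10, 83, 43, 60, 25, 84, 19,
     51, 2, 82, 4, 78, 33, 77, 44, 89, 34, 76, 38, 93, 30, 69, 39, 73, 15, 53, 42, 88, 27, 55, 3,
     70, 45, 85, 14, 21, 90, 97, 31, 79, 20, 57, 18, 80, 46, 67, 24, 71, 64, 7, 92, 36, 94, 9, 65,
     17, 74]
    [0, 2, 4, 54, 5, 7, 8, 9, 59, 10, 11, 13, 14, 16, 66, 17, 18, 68, 19, 20, 70, 21, 71, 69, 67,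
     65, 15, 64, 63, 62, 12, 61, 60, 58, 57, 56, 6, 55, 53, 3, 52, 51, 1, 50, 49, 48, 97, 96, 47,
     22, 24, 74, 25, 27, 76, 26, 28, 78, 29, 30, 32, 82, 33, 35, 85, 36, 37, 39, 89, 40, 42, 43,
     44, 45, 46, 95, 94, 93, 92, 91, 41, 90, 88, 38, 87, 86, 84, 34, 83, 81, 31, 80, 79, 77, 75,
     73, 23, 72]
    [0, 1, 3, 5, 55, 6, 8, 58, 9, 10, 12, 62, 13, 15, 65, 16, 17, 19, 69, 20, 22, 71, 21, 70, 68,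
     18, 67, 66, 64, 14, 63, 61, 11, 60, 59, 57, 7, 56, 54, 4, 53, 51, 2, 52, 50, 97, 47, 48, 49,
     23, 73, 24, 25, 26, 27, 28, 29, 79, 30, 31, 81, 32, 33, 34, 36, 38, 88, 39, 40, 90, 41, 43,
     93, 44, 46, 96, 95, 45, 94, 92, 42, 91, 89, 87, 37, 86, 85, 35, 84, 83, 82, 80, 78, 77, 76,
     75, 74, 72]
    [[0, 21, 42, 14, 28, 6, 20, 41, 13, 27, 48, 26, 47, 19, 40, 5, 32, 4, 31, 3, 24, 45, 10, 37,
      15, 29, 7, 34, 12, 33, 11, 25, 46, 18, 39, 17, 38, 16, 30, 2, 23, 44, 9, 36, 1, 22, 43, 8,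
      35],
     [0, 14, 35, 13, 34, 6, 27, 41, 19, 33, 5, 26, 40, 12, 39, 4, 18, 32, 46, 11, 38, 10, 24, 2,
      16, 43, 15, 36, 8, 29, 1, 28, 42, 7, 21, 48, 20, 47, 25, 3, 17, 31, 45, 23, 37, 9, 30, 44,
      22],
     [0, 27, 5, 19, 46, 24, 38, 3, 30, 8, 22, 36, 14, 41, 6, 33, 47, 12, 26, 4, 25, 39, 11, 32,
      10, 31, 9, 23, 1, 15, 42, 20, 34, 48, 13, 40, 18, 45, 17, 44, 16, 37, 2, 29, 43, 21, 35, 7,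
      28]]

theorem check49 : check 49 rows49 = true := by decide +kernel

end RCD


/-- For every odd `m` with `5 ≤ m ≤ 49`, the complete symmetric digraph
`K_{2m}^*` admits a resolvable decomposition into directed `m`-cycles:
there are `2m - 1` resolution classes, each consisting of two vertex-disjoint
directed `m`-cycles covering all `2m` vertices (so `2(2m-1)` cycles in total),
and the arc sets of all these cycles partition the arc set of `K_{2m}^*`. -/
theorem hasRCD_two_m (m : ℕ) (hodd : Odd m) (h5 : 5 ≤ m) (h49 : m ≤ 49) :
    ∃ C C' : Fin (2 * m - 1) → ZMod m → Fin (2 * m),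
      (∀ r, Function.Injective (C r) ∧ Function.Injective (C' r) ∧
        Disjoint (Set.range (C r)) (Set.range (C' r)) ∧
        Set.range (C r) ∪ Set.range (C' r) = Set.univ) ∧
      (∀ u v : Fin (2 * m), u ≠ v →
        ∃! x : Fin (2 * m - 1) × Bool × ZMod m,
          ((cond x.2.1 (C x.1) (C' x.1)) x.2.2,
           (cond x.2.1 (C x.1) (C' x.1)) (x.2.2 + 1)) = (u, v)) := by
  have hcases : m = 5 ∨ m = 7 ∨ m = 9 ∨ m = 11 ∨ m = 13 ∨ m = 15 ∨
      m = 17 ∨ m = 19 ∨ m = 21 ∨ m = 23 ∨ m = 25 ∨ m = 27 ∨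
      m = 29 ∨ m = 31 ∨ m = 33 ∨ m = 35 ∨ m = 37 ∨ m = 39 ∨
      m = 41 ∨ m = 43 ∨ m = 45 ∨ m = 47 ∨ m = 49 := by
    obtain ⟨k, rfl⟩ := hodd
    omega
  rcases hcases with rfl | rfl | rfl | rfl | rfl | rfl | rfl | rfl | rfl | rfl | rfl | rfl |
    rfl | rfl | rfl | rfl | rfl | rfl | rfl | rfl | rfl | rfl | rfl
  · exact RCD.of_check 5 (by norm_num) RCD.rows5 RCD.check5
  · exact RCD.of_check 7 (by norm_num) RCD.rows7 RCD.check7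
  · exact RCD.of_check 9 (by norm_num) RCD.rows9 RCD.check9
  · exact RCD.of_check 11 (by norm_num) RCD.rows11 RCD.check11
  · exact RCD.of_check 13 (by norm_num) RCD.rows13 RCD.check13
  · exact RCD.of_check 15 (by norm_num) RCD.rows15 RCD.check15
  · exact RCD.of_check 17 (by norm_num) RCD.rows17 RCD.check17
  · exact RCD.of_check 19 (by norm_num) RCD.rows19 RCD.check19
  · exact RCD.of_check 21 (by norm_num) RCD.rows21 RCD.check21
  · exact RCD.of_check 23 (by norm_num) RCD.rows23 RCD.check23
  · exact RCD.of_check 25 (by norm_num) RCD.rows25 RCD.check25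
  · exact RCD.of_check 27 (by norm_num) RCD.rows27 RCD.check27
  · exact RCD.of_check 29 (by norm_num) RCD.rows29 RCD.check29
  · exact RCD.of_check 31 (by norm_num) RCD.rows31 RCD.check31
  · exact RCD.of_check 33 (by norm_num) RCD.rows33 RCD.check33
  · exact RCD.of_check 35 (by norm_num) RCD.rows35 RCD.check35
  · exact RCD.of_check 37 (by norm_num) RCD.rows37 RCD.check37
  · exact RCD.of_check 39 (by norm_num) RCD.rows39 RCD.check39
  · exact RCD.of_check 41 (by norm_num) RCD.rows41 RCD.check41
  · exact RCD.of_check 43 (by norm_num) RCD.rows43 RCD.check43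
  · exact RCD.of_check 45 (by norm_num) RCD.rows45 RCD.check45
  · exact RCD.of_check 47 (by norm_num) RCD.rows47 RCD.check47
  · exact RCD.of_check 49 (by norm_num) RCD.rows49 RCD.check49
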